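/- Let K be a field, n ≥ 3, and let M = S_n(Sym_n) be the monoid presented by generators a_1, …, a_n and relations a_1 a_2 ⋯ a_n = a_{σ(1)} ⋯ a_{σ(n)} for all σ ∈ Sym_n. Let z = a_1 ⋯ a_n and let K[Mz] be the K-linear span of the ideal Mz in the monoid algebra K[M]. Then the quotient ring K[M]/K[Mz] is (left and right) primitive, i.e. it admits a faithful simple left module and a faithful simple right module. -/

import Mathlib

/-- The word `a_{σ(1)} a_{σ(2)} ⋯ a_{σ(n)}` in the free monoid on `n` generators. -/
def permWord (n : ℕ) (σ : Equiv.Perm (Fin n)) : FreeMonoid (Fin n) :=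
  ((List.finRange n).map fun i => FreeMonoid.of (σ i)).prod

/-- The defining relations `a_1 a_2 ⋯ a_n = a_{σ(1)} a_{σ(2)} ⋯ a_{σ(n)}` for all
permutations `σ ∈ Sym_n`. -/
def symRel (n : ℕ) : FreeMonoid (Fin n) → FreeMonoid (Fin n) → Prop :=
  fun x y => x = permWord n 1 ∧ ∃ σ : Equiv.Perm (Fin n), y = permWord n σ

/-- The monoid `M = S_n(Sym_n)` presented by generators `a_1, …, a_n` and the above relations. -/
def Msym (n : ℕ) : Type := (conGen (symRel n)).Quotient

instance (n : ℕ) : Monoid (Msym n) := Con.monoid _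

/-- The generator `a_i` of `M`. -/
def mgen {n : ℕ} (i : Fin n) : Msym n := (conGen (symRel n)).mk' (FreeMonoid.of i)

/-- The element `z = a_1 a_2 ⋯ a_n` of `M`. -/
def zs (n : ℕ) : Msym n := ((List.finRange n).map mgen).prod

/-- A word is *good* if none of its factors of length `n` consists of distinct letters. -/
def GoodWord {ι : Type*} (n : ℕ) (w : List ι) : Prop :=
  ∀ u, u <:+: w → u.length = n → ¬ u.Nodup

namespace GoodWord

variable {ι : Type*} {n : ℕ}

theorem of_infix {v w : List ι} (h : GoodWord n w) (hv : v <:+: w) : GoodWord n v :=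
  fun u hu => h u (hu.trans hv)

theorem reverse {w : List ι} (h : GoodWord n w) : GoodWord n w.reverse := by
  intro u hu hl hd
  refine h u.reverse ?_ (by simpa using hl) (List.nodup_reverse.2 hd)
  rw [← List.reverse_infix]
  simpa using hu

theorem of_length_lt {w : List ι} (h : w.length < n) : GoodWord n w := by
  intro u hu hl
  have := hu.length_le
  omega

theorem cons {w : List ι} {a : ι} (h : GoodWord n w)
    (ha : ∀ u, u <+: a :: w → u.length = n → ¬ u.Nodup) : GoodWord n (a :: w) := by
  intro u hu
  rcases List.infix_cons_iff.1 hu with hu | hu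
  · exact ha u hu
  · exact h u hu

/-- A word is good if its tail is, and its first three letters are not distinct. -/
theorem cons_of_not_nodup (hn : 3 ≤ n) {w : List ι} {a b c : ι}
    (h : GoodWord n (b :: c :: w)) (hd : ¬ [a, b, c].Nodup) : GoodWord n (a :: b :: c :: w) := by
  refine h.cons fun u hu hl hu' => hd ?_
  obtain ⟨t, ht⟩ := hu
  match u, hl with
  | [], hl => simp at hl; omega
  | [_], hl => simp at hl; omega
  | [_, _], hl => simp at hl; omega
  | x :: y :: z :: u, _ =>
    simp only [List.cons_append, List.cons.injEq] at ht
    obtain ⟨rfl, rfl, rfl, -⟩ := ht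
    exact hu'.sublist (by simp)

theorem cons_cons_self (hn : 3 ≤ n) {w : List ι} {a : ι}
    (h : GoodWord n (a :: w)) : GoodWord n (a :: a :: w) := by
  cases w with
  | nil => exact of_length_lt (by simp; omega)
  | cons c w => exact h.cons_of_not_nodup hn (by simp)

theorem exists_cons_cons_append (hn : 3 ≤ n) (a : ι) {w : List ι} (h : GoodWord n w) :
    ∃ p, GoodWord n (a :: a :: (p ++ w)) := by
  cases w with
  | nil => exact ⟨[], of_length_lt (by simp; omega)⟩
  | cons x w =>
    exact ⟨[x], ((h.cons_cons_self hn).cons_of_not_nodup hn (by simp)).cons_cons_self hn⟩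

theorem exists_append (hn : 3 ≤ n) (a : ι) {w : List ι} (h : GoodWord n w) :
    ∃ p, GoodWord n (w ++ (p ++ [a, a])) := by
  obtain ⟨p, hp⟩ := h.reverse.exists_cons_cons_append hn a
  exact ⟨p.reverse, by simpa using hp.reverse⟩

theorem replicate_append (hn : 3 ≤ n) {w : List ι} {a : ι} (h : GoodWord n (a :: w)) (m : ℕ) :
    GoodWord n (List.replicate m a ++ a :: w) := by
  induction m with
  | zero => exact h
  | succ m ih =>
    rw [List.replicate_succ, List.cons_append]
    cases m with
    | zero => exact h.cons_cons_self hn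
    | succ m =>
      rw [List.replicate_succ, List.cons_append] at ih ⊢
      exact ih.cons_cons_self hn

/-- Two good words can be glued along a repeated letter. -/
theorem glue {v w : List ι} {a : ι} (hv : GoodWord n (v ++ [a, a]))
    (hw : GoodWord n (a :: a :: w)) : GoodWord n (v ++ [a, a] ++ w) := by
  induction v with
  | nil => exact hw
  | cons c v ih =>
    refine (ih (hv.of_infix (List.suffix_cons _ _).isInfix)).cons fun u hu hl hd => ?_
    rcases le_total u.length (c :: v ++ [a, a]).length with h | h
    · exact hv u (List.prefix_of_prefix_length_le hu (List.prefix_append _ _) h).isInfix hl hd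
    · have : c :: v ++ [a, a] <+: u :=
        List.prefix_of_prefix_length_le (List.prefix_append _ w) hu h
      have h2 := (hd.sublist this.sublist).sublist (List.sublist_append_right _ _)
      simp at h2

/-- Every good word can be embedded in a loop word, far from the end of the loop. -/
theorem exists_loop (hn : 3 ≤ n) (a b : ι) {w : List ι} (h : GoodWord n w) (N : ℕ) :
    ∃ p q, GoodWord n (b :: b :: (p ++ w ++ q ++ [b, b])) ∧ N ≤ q.length := by
  obtain ⟨q, hq⟩ := h.exists_append hn a
  have h1 := hq.reverse
  simp only [List.reverse_append, List.reverse_cons, List.reverse_nil, List.nil_append,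
    List.cons_append] at h1
  obtain ⟨r, hr⟩ := (h1.replicate_append hn N).exists_cons_cons_append hn b
  obtain ⟨p, hp⟩ := hr.reverse.exists_cons_cons_append hn b
  refine ⟨p, q ++ [a, a] ++ List.replicate N a ++ r.reverse, ?_, by simp; omega⟩
  convert hp using 1
  simp

end GoodWord

/-- `LabelPath E w s t` says that there is a path with label `w` from `s` to `t` in the labelled
graph `E`. -/
def LabelPath {ι S : Type*} (E : ι → S → S → Prop) : List ι → S → S → Prop
  | [], s, t => s = t
  | a :: w, s, t => ∃ m, E a s m ∧ LabelPath E w m t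

namespace LabelPath

variable {ι S : Type*} {E : ι → S → S → Prop}

theorem append {v w : List ι} {s m t : S} (h : LabelPath E v s m) (h' : LabelPath E w m t) :
    LabelPath E (v ++ w) s t := by
  induction v generalizing s with
  | nil => cases h; exact h'
  | cons a v ih =>
    obtain ⟨x, hx, hv⟩ := h
    exact ⟨x, hx, ih hv⟩

theorem right_unique (hE : ∀ a s t t', E a s t → E a s t' → t = t') {w : List ι} {s t t' : S}
    (h : LabelPath E w s t) (h' : LabelPath E w s t') : t = t' := by
  induction w generalizing s with
  | nil => exact h.symm.trans h'
  | cons a w ih =>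
    obtain ⟨x, hx, h⟩ := h
    obtain ⟨y, hy, h'⟩ := h'
    obtain rfl := hE _ _ _ _ hx hy
    exact ih h h'

theorem left_unique (hE : ∀ a s s' t, E a s t → E a s' t → s = s') {w : List ι} {s s' t : S}
    (h : LabelPath E w s t) (h' : LabelPath E w s' t) : s = s' := by
  induction w generalizing s s' with
  | nil => exact h.trans h'.symm
  | cons a w ih =>
    obtain ⟨x, hx, h⟩ := h
    obtain ⟨y, hy, h'⟩ := h'
    obtain rfl := ih h h'
    exact hE _ _ _ _ hx hy

end LabelPath

/-- A labelled graph in which every letter acts as a partial injection, which is strongly connected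
(via the base vertex `o`), in which `o` is distinguished from the other vertices by the labels of
outgoing paths, in which all labels of paths are good words, and in which all good words of bounded
length can be detected. -/
structure IsPrimitiveGraph {ι S : Type*} (n : ℕ) (E : ι → S → S → Prop) (o : S) : Prop where
  right_unique : ∀ a s t t', E a s t → E a s t' → t = t'
  left_unique : ∀ a s s' t, E a s t → E a s' t → s = s'
  to_base : ∀ s, ∃ w, LabelPath E w s o
  from_base : ∀ s, ∃ w, LabelPath E w o s
  separated : ∀ s, s ≠ o → ∃ w, ¬ ((∃ t, LabelPath E w s t) ↔ ∃ t, LabelPath E w o t)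
  good : ∀ w s t, LabelPath E w s t → GoodWord n w
  detects : ∀ w, GoodWord n w → ∀ N : ℕ, ∃ s t, LabelPath E w s t ∧
    ∀ w', w'.length ≤ N → LabelPath E w' s t → w' = w

theorem IsPrimitiveGraph.exists_separating {ι S : Type*} {n : ℕ} {E : ι → S → S → Prop} {o : S}
    (h : IsPrimitiveGraph n E o) {s t : S} (hst : s ≠ t) :
    ∃ w, ¬ ((∃ u, LabelPath E w s u) ↔ ∃ u, LabelPath E w t u) := by
  obtain ⟨v, hv⟩ := h.to_base t
  by_cases hs : ∃ u, LabelPath E v s u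
  · obtain ⟨u, hu⟩ := hs
    have huo : u ≠ o := by
      rintro rfl
      exact hst (hu.left_unique h.left_unique hv)
    obtain ⟨w, hw⟩ := h.separated u huo
    have key : ∀ {x y}, LabelPath E v x y →
        ((∃ z, LabelPath E (v ++ w) x z) ↔ ∃ z, LabelPath E w y z) := by
      intro x y hxy
      refine ⟨fun ⟨z, hz⟩ => ?_, fun ⟨z, hz⟩ => ⟨z, hxy.append hz⟩⟩
      suffices ∀ (v : List ι) (x : S), LabelPath E v x y → LabelPath E (v ++ w) x z →
        LabelPath E w y z from ⟨z, this v x hxy hz⟩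
      intro v
      induction v with
      | nil => rintro x rfl hz; exact hz
      | cons a v ih =>
        rintro x ⟨m, hm, h1⟩ ⟨m', hm', h2⟩
        obtain rfl := h.right_unique _ _ _ _ hm hm'
        exact ih m h1 h2
    exact ⟨v ++ w, by rwa [key hu, key hv]⟩
  · exact ⟨v, fun hiff => hs (hiff.2 ⟨o, hv⟩)⟩

section LoopGraph

variable {ι : Type*}

/-- The vertices of the loop graph with loops `L k`: the pair `(k, r)` stands for the point of the
`k`-th loop from which the word `r` remains to be read, and the hub of the `k`-th loop is
`(k, [])`. -/
abbrev LoopVertex (L : ℕ → List ι) : Type _ := {s : ℕ × List ι // s.2 <:+ L s.1}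

/-- The edges of the loop graph: advance in a loop, move from a hub to the next one with the
letter `a`, or enter the loop leading to the previous hub with the letter `b`. -/
def LoopEdge (a b : ι) (L : ℕ → List ι) (c : ι) (s t : LoopVertex L) : Prop :=
  (s.1.1 = t.1.1 ∧ s.1.2 = c :: t.1.2) ∨
  (c = a ∧ s.1.2 = [] ∧ t.1.2 = [] ∧ t.1.1 = s.1.1 + 1) ∨
  (c = b ∧ s.1.2 = [] ∧ s.1.1 = t.1.1 + 1 ∧ t.1.2 = L t.1.1)

variable {a b : ι} {L : ℕ → List ι}

/-- The `k`-th hub of the loop graph. -/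
def loopHub (L : ℕ → List ι) (k : ℕ) : LoopVertex L := ⟨(k, []), List.nil_suffix⟩

theorem labelPath_loop {k : ℕ} {v r : List ι} (h : v ++ r <:+ L k) :
    LabelPath (LoopEdge a b L) v ⟨(k, v ++ r), h⟩
      ⟨(k, r), (List.suffix_append v r).trans h⟩ := by
  induction v with
  | nil => rfl
  | cons c v ih => exact ⟨⟨(k, v ++ r), (List.suffix_cons c _).trans h⟩, .inl ⟨rfl, rfl⟩, ih _⟩

theorem labelPath_loop_to_hub {k : ℕ} {r : List ι} (h : r <:+ L k) :
    LabelPath (LoopEdge a b L) r ⟨(k, r), h⟩ (loopHub L k) := by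
  induction r with
  | nil => rfl
  | cons c r ih => exact ⟨⟨(k, r), (List.suffix_cons c _).trans h⟩, .inl ⟨rfl, rfl⟩, ih _⟩

theorem labelPath_replicate_hub (k m : ℕ) :
    LabelPath (LoopEdge a b L) (List.replicate m a) (loopHub L k) (loopHub L (k + m)) := by
  induction m generalizing k with
  | zero => rfl
  | succ m ih =>
    refine ⟨loopHub L (k + 1), .inr (.inl ⟨rfl, rfl, rfl, rfl⟩), ?_⟩
    have := ih (k + 1)
    rwa [add_right_comm, add_assoc] at this

theorem labelPath_hub_zero (k : ℕ) :
    ∃ w, LabelPath (LoopEdge a b L) w (loopHub L k) (loopHub L 0) := by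
  induction k with
  | zero => exact ⟨[], rfl⟩
  | succ k ih =>
    obtain ⟨w, hw⟩ := ih
    exact ⟨b :: (L k ++ w), ⟨(k, L k), List.suffix_rfl⟩, .inr (.inr ⟨rfl, rfl, rfl, rfl⟩),
      (labelPath_loop_to_hub _).append hw⟩

theorem isPrefix_of_labelPath_loop {w r : List ι} {k : ℕ} {h : r <:+ L k} {t : LoopVertex L}
    (hw : LabelPath (LoopEdge a b L) w ⟨(k, r), h⟩ t) (hl : w.length ≤ r.length) :
    t.1.1 = k ∧ r = w ++ t.1.2 := by
  induction w generalizing r with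
  | nil => obtain rfl := hw; simp
  | cons c w ih =>
    obtain ⟨⟨⟨k', r'⟩, h'⟩, hm, hw⟩ := hw
    cases r with
    | nil => simp at hl
    | cons d r =>
      simp only [LoopEdge, List.cons.injEq, reduceCtorEq, false_and, and_false, or_false] at hm
      obtain ⟨rfl, rfl, rfl⟩ := hm
      obtain ⟨h1, h2⟩ := ih hw (by simpa using hl)
      exact ⟨h1, by rw [List.cons_append, ← h2]⟩

theorem loopEdge_right_unique (hab : a ≠ b) {c : ι} {s t t' : LoopVertex L}
    (h : LoopEdge a b L c s t) (h' : LoopEdge a b L c s t') : t = t' := by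
  obtain ⟨⟨k, r⟩, hs⟩ := s
  obtain ⟨⟨k', r'⟩, ht⟩ := t
  obtain ⟨⟨k'', r''⟩, ht'⟩ := t'
  simp only [LoopEdge] at h h'
  simp only [Subtype.mk.injEq, Prod.mk.injEq]
  grind

theorem loopEdge_left_unique (hab : a ≠ b) (ha : ∀ k, ¬ [a] <:+ L k)
    {c : ι} {s s' t : LoopVertex L}
    (h : LoopEdge a b L c s t) (h' : LoopEdge a b L c s' t) : s = s' := by
  obtain ⟨⟨k, r⟩, hs⟩ := s
  obtain ⟨⟨k', r'⟩, hs'⟩ := s'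
  obtain ⟨⟨l, u⟩, ht⟩ := t
  simp only [LoopEdge] at h h' hs hs'
  have := hs.length_le
  have := hs'.length_le
  simp only [Subtype.mk.injEq, Prod.mk.injEq]
  grind

/-- Labels of paths from a hub remain good after prepending `a` or `b`, and labels of paths from
inside a loop remain good after prepending the part of the loop already passed. -/
theorem good_of_labelPath {n : ℕ} (hn : 3 ≤ n) {m : ℕ → List ι}
    (hL : ∀ k, L k = b :: (m k ++ [b, b])) (hg : ∀ k, GoodWord n (b :: L k)) (w : List ι) :
    (∀ k t, LabelPath (LoopEdge a b L) w (loopHub L k) t →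
      GoodWord n (a :: w) ∧ GoodWord n (b :: w)) ∧
    (∀ k r (h : r <:+ L k) t c, r ≠ [] → c ++ r = b :: L k →
      LabelPath (LoopEdge a b L) w ⟨(k, r), h⟩ t → GoodWord n (c ++ w)) := by
  induction w with
  | nil =>
    refine ⟨fun _ _ _ => ⟨.of_length_lt (by simp; omega), .of_length_lt (by simp; omega)⟩, ?_⟩
    rintro k r h t c - hc -
    rw [List.append_nil]
    exact (hg k).of_infix (hc ▸ List.infix_append' [] c r)
  | cons x w ih =>
    obtain ⟨ih1, ih2⟩ := ih
    have hub : ∀ k t, LabelPath (LoopEdge a b L) w (loopHub L k) t → ∀ x y,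
        (x = a ∨ x = b) → (y = a ∨ y = b) → GoodWord n (x :: y :: w) := by
      intro k t hw x y hx hy
      have h1 : GoodWord n (y :: w) := by
        rcases hy with rfl | rfl
        · exact (ih1 k t hw).1
        · exact (ih1 k t hw).2
      cases w with
      | nil => exact .of_length_lt (by simp; omega)
      | cons z w =>
        refine h1.cons_of_not_nodup hn ?_
        obtain ⟨u, hu, -⟩ := hw
        simp only [LoopEdge, loopHub, reduceCtorEq, and_false, false_or] at hu
        grind
    constructor
    · rintro k t ⟨⟨⟨k', r⟩, h⟩, hm, hw⟩
      simp only [LoopEdge, loopHub, reduceCtorEq, and_false, false_or, true_and] at hm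
      rcases hm with ⟨rfl, rfl, rfl⟩ | ⟨rfl, rfl, rfl⟩
      · exact ⟨hub _ t hw _ _ (.inl rfl) (.inl rfl), hub _ t hw _ _ (.inr rfl) (.inl rfl)⟩
      · have h1 : GoodWord n (x :: w) :=
          ih2 k' (L k') h t [x] (by simp [hL]) (by simp) hw
        cases w with
        | nil => exact ⟨.of_length_lt (by simp; omega), .of_length_lt (by simp; omega)⟩
        | cons z w =>
          have hz : z = x := by
            obtain ⟨u, hu, -⟩ := hw
            simp only [LoopEdge, hL] at hu
            grind
          subst hz
          exact ⟨h1.cons_of_not_nodup hn (by simp), h1.cons_of_not_nodup hn (by simp)⟩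
    · rintro k r h t c hr hc ⟨⟨⟨k', r'⟩, h'⟩, hm, hw⟩
      obtain ⟨rfl, rfl⟩ : k = k' ∧ r = x :: r' := by
        simp only [LoopEdge] at hm
        tauto
      by_cases hr' : r' = []
      · subst hr'
        have hx : x = b ∧ c = b :: b :: (m k ++ [b]) := by
          rw [hL] at hc
          have : c ++ [x] = (b :: b :: (m k ++ [b])) ++ [b] := by simpa using hc
          rw [List.append_inj' this rfl |>.1]
          simpa using (List.append_inj' this rfl).2
        obtain ⟨rfl, rfl⟩ := hx
        have h1 := hg k
        rw [hL] at h1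
        have := GoodWord.glue (v := x :: x :: m k) (by simpa using h1)
          (hub _ t hw _ _ (.inr rfl) (.inr rfl))
        simpa using this
      · have := ih2 k r' h' t (c ++ [x]) hr' (by simpa using hc) hw
        simpa using this

theorem isPrimitiveGraph_loop {n : ℕ} (hn : 3 ≤ n) (hab : a ≠ b) {m : ℕ → List ι}
    (hL : ∀ k, L k = b :: (m k ++ [b, b])) (hg : ∀ k, GoodWord n (b :: L k))
    (hm : ∀ w, GoodWord n w → ∀ N, ∃ k p q, m k = p ++ w ++ q ∧ N ≤ q.length) :
    IsPrimitiveGraph n (LoopEdge a b L) (loopHub L 0) where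
  right_unique _ _ _ _ := loopEdge_right_unique hab
  left_unique _ _ _ _ := loopEdge_left_unique hab fun k h => by
    rw [hL] at h
    have hb : [b] <:+ b :: (m k ++ [b, b]) := ⟨b :: (m k ++ [b]), by simp⟩
    have := (List.suffix_of_suffix_length_le h hb le_rfl).eq_of_length rfl
    simp_all
  to_base := by
    rintro ⟨⟨k, r⟩, h⟩
    obtain ⟨w, hw⟩ := labelPath_hub_zero (a := a) (b := b) (L := L) k
    exact ⟨_, (labelPath_loop_to_hub h).append hw⟩
  from_base := by
    rintro ⟨⟨k, r⟩, h⟩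
    obtain ⟨v, hv⟩ := h
    have h1 := labelPath_replicate_hub (a := a) (b := b) (L := L) 0 (k + 1)
    have h2 : LabelPath (LoopEdge a b L) [b] (loopHub L (0 + (k + 1)))
        ⟨(k, v ++ r), by simp only at hv; rw [hv]⟩ :=
      ⟨_, .inr (.inr ⟨rfl, rfl, by simp [loopHub], hv⟩), rfl⟩
    exact ⟨_, (h1.append h2).append (labelPath_loop _)⟩
  separated := by
    rintro ⟨⟨k, r⟩, h⟩ hs
    by_cases hr : r = []
    · subst hr
      obtain ⟨k, rfl⟩ := Nat.exists_eq_succ_of_ne_zero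
        (show k ≠ 0 by rintro rfl; exact hs rfl)
      refine ⟨[b], fun hiff => ?_⟩
      obtain ⟨t, u, hu, -⟩ := hiff.1
        ⟨_, ⟨(k, L k), List.suffix_rfl⟩, .inr (.inr ⟨rfl, rfl, rfl, rfl⟩), rfl⟩
      simp [LoopEdge, loopHub, hab.symm] at hu
    · refine ⟨List.replicate r.length a, fun hiff => ?_⟩
      obtain ⟨t, ht⟩ := hiff.2 ⟨_, labelPath_replicate_hub 0 _⟩
      obtain ⟨-, h1⟩ := isPrefix_of_labelPath_loop ht (by simp)
      have h2 : t.1.2 = [] := by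
        have := congrArg List.length h1
        simpa using this
      rw [h2, List.append_nil] at h1
      have hb : b ∈ r := by
        have h3 : [b] <:+ L k := ⟨b :: (m k ++ [b]), by simp [hL]⟩
        have h4 := List.suffix_of_suffix_length_le h3 h
          (by simpa [Nat.one_le_iff_ne_zero] using hr)
        exact h4.subset (by simp)
      rw [h1] at hb
      exact hab (List.eq_of_mem_replicate hb).symm
  good w := by
    rintro ⟨⟨k, r⟩, h⟩ t hw
    obtain ⟨h1, h2⟩ := good_of_labelPath (a := a) hn hL hg w
    by_cases hr : r = []
    · subst hr
      exact (h1 k t hw).1.of_infix (List.suffix_cons _ _).isInfix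
    · obtain ⟨c, hc⟩ := h
      exact (h2 k r ⟨c, hc⟩ t (b :: c) hr (by simpa using hc) hw).of_infix
        (List.suffix_append _ _).isInfix
  detects w hw N := by
    obtain ⟨k, p, q, hk, hq⟩ := hm w hw N
    have hs : w ++ (q ++ [b, b]) <:+ L k := ⟨b :: p, by simp [hL, hk]⟩
    refine ⟨_, _, labelPath_loop hs, fun w' hw' hp => ?_⟩
    have := (isPrefix_of_labelPath_loop hp (by simp; omega)).2
    exact (List.append_cancel_right this).symm

theorem exists_isPrimitiveGraph.{v} {ι : Type v} [Countable ι] {a b : ι} {n : ℕ} (hn : 3 ≤ n) (hab : a ≠ b) :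
    ∃ (S : Type v) (E : ι → S → S → Prop) (o : S), IsPrimitiveGraph n E o := by
  have : Nonempty ({w : List ι // GoodWord n w} × ℕ) :=
    ⟨⟨[], .of_length_lt (by simp; omega)⟩, 0⟩
  obtain ⟨f, hf⟩ := exists_surjective_nat ({w : List ι // GoodWord n w} × ℕ)
  choose p q h hq using fun k => (f k).1.2.exists_loop hn a b (f k).2
  refine ⟨_, _, _, isPrimitiveGraph_loop hn hab (m := fun k => p k ++ (f k).1 ++ q k)
    (fun k => rfl) h fun w hw N => ?_⟩
  obtain ⟨k, hk⟩ := hf (⟨w, hw⟩, N)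
  refine ⟨k, p k, q k, by simp [hk], ?_⟩
  have := hq k
  rwa [hk] at this

end LoopGraph

section PrimitiveModule

universe u

/-- The algebra `R` is spanned by the products of the elements `x i` along good words and is
universal among algebras (of the universe level `u`) in which the products of `n` generators with
distinct indices vanish. -/
structure IsGoodWordAlgebra (K : Type u) {ι R : Type*} [Field K] [Ring R] [Algebra K R]
    (n : ℕ) (x : ι → R) : Prop where
  span_eq_top : Submodule.span K {r | ∃ w, GoodWord n w ∧ (w.map x).prod = r} = ⊤
  exists_lift : ∀ (B : Type u) [Ring B] [Algebra K B] (y : ι → B),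
    (∀ w : List ι, w.length = n → w.Nodup → (w.map y).prod = 0) →
    ∃ φ : R →ₐ[K] B, ∀ i, φ (x i) = y i

variable {K : Type u} {ι R : Type*} [Field K] [Ring R] [Algebra K R] {n : ℕ} {x : ι → R}

open MulOpposite in
protected theorem IsGoodWordAlgebra.op (h : IsGoodWordAlgebra K n x) :
    IsGoodWordAlgebra K n (fun i => MulOpposite.op (x i)) where
  span_eq_top := by
    have h1 := congrArg (Submodule.map (opLinearEquiv K (M := R)).toLinearMap) h.span_eq_top
    rw [Submodule.map_span, Submodule.map_top, LinearEquiv.range] at h1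
    rw [← h1]
    congr 1
    ext r
    constructor
    · rintro ⟨w, hw, rfl⟩
      refine ⟨_, ⟨w.reverse, hw.reverse, rfl⟩, ?_⟩
      simp [op_list_prod, List.map_reverse, Function.comp_def]
    · rintro ⟨_, ⟨w, hw, rfl⟩, rfl⟩
      refine ⟨w.reverse, hw.reverse, ?_⟩
      simp [op_list_prod, List.map_reverse, Function.comp_def]
  exists_lift B _ _ y hy := by
    obtain ⟨φ, hφ⟩ := h.exists_lift Bᵐᵒᵖ (fun i => MulOpposite.op (y i)) fun w hl hd => by
      have := hy w.reverse (by simpa using hl) (List.nodup_reverse.2 hd)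
      rw [← unop_eq_zero_iff, unop_list_prod]
      simpa [Function.comp_def, List.map_reverse] using this
    exact ⟨AlgHom.opComm φ, fun i => by simp [hφ]⟩

variable {S : Type*} {E : ι → S → S → Prop} {o : S}

open Classical in
/-- The endomorphism of the free module on the vertices of a labelled graph given by following the
edges with the label `a`. -/
noncomputable def edgeMap (K : Type*) [Field K] (E : ι → S → S → Prop) (a : ι) :
    Module.End K (S →₀ K) :=
  Finsupp.linearCombination K fun s =>
    if h : ∃ t, E a s t then Finsupp.single h.choose (1 : K) else 0

theorem edgeMap_single (hE : ∀ a s t t', E a s t → E a s t' → t = t') {a : ι} {s t : S}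
    (h : E a s t) (c : K) : edgeMap K E a (Finsupp.single s c) = Finsupp.single t c := by
  have h' : ∃ t, E a s t := ⟨t, h⟩
  simp [edgeMap, dif_pos h', hE _ _ _ _ h'.choose_spec h]

theorem edgeMap_single_eq_zero {a : ι} {s : S}
    (h : ¬ ∃ t, E a s t) (c : K) : edgeMap K E a (Finsupp.single s c) = 0 := by
  simp [edgeMap, dif_neg h]

theorem prod_edgeMap_single (hE : ∀ a s t t', E a s t → E a s t' → t = t') {w : List ι} {s t : S}
    (h : LabelPath E w s t) (c : K) :
    (w.map (edgeMap K E)).reverse.prod (Finsupp.single s c) = Finsupp.single t c := by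
  induction w generalizing s with
  | nil => obtain rfl := h; simp
  | cons a w ih =>
    obtain ⟨m, hm, h⟩ := h
    rw [List.map_cons, List.reverse_cons, List.prod_append, List.prod_singleton,
      Module.End.mul_apply, edgeMap_single hE hm, ih h]

theorem prod_edgeMap_single_eq_zero (hE : ∀ a s t t', E a s t → E a s t' → t = t')
    {w : List ι} {s : S} (h : ¬ ∃ t, LabelPath E w s t) (c : K) :
    (w.map (edgeMap K E)).reverse.prod (Finsupp.single s c) = 0 := by
  induction w generalizing s with
  | nil => exact absurd ⟨s, rfl⟩ h
  | cons a w ih =>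
    rw [List.map_cons, List.reverse_cons, List.prod_append, List.prod_singleton,
      Module.End.mul_apply]
    by_cases hm : ∃ m, E a s m
    · obtain ⟨m, hm⟩ := hm
      rw [edgeMap_single hE hm]
      exact ih fun ⟨t, ht⟩ => h ⟨t, m, hm, ht⟩
    · rw [edgeMap_single_eq_zero hm, map_zero]

theorem prod_edgeMap_apply (hE : ∀ a s t t', E a s t → E a s t' → t = t')
    (hE' : ∀ a s s' t, E a s t → E a s' t → s = s') {w : List ι} {s t : S}
    (h : LabelPath E w s t) (v : S →₀ K) :
    (w.map (edgeMap K E)).reverse.prod v t = v s := by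
  classical
  induction v using Finsupp.induction_linear with
  | zero => simp
  | add f g hf hg => simp [hf, hg]
  | single r c =>
    by_cases hr : ∃ u, LabelPath E w r u
    · obtain ⟨u, hu⟩ := hr
      rw [prod_edgeMap_single hE hu, Finsupp.single_apply, Finsupp.single_apply]
      congr 1
      refine propext ⟨?_, ?_⟩
      · rintro rfl
        exact hu.left_unique hE' h
      · rintro rfl
        exact hu.right_unique hE h
    · rw [prod_edgeMap_single_eq_zero hE hr, Finsupp.single_apply, if_neg]
      · rfl
      · rintro rfl
        exact hr ⟨t, h⟩

theorem prod_edgeMap_apply_eq_zero (hE : ∀ a s t t', E a s t → E a s t' → t = t')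
    {w : List ι} {t : S} (h : ¬ ∃ s, LabelPath E w s t) (v : S →₀ K) :
    (w.map (edgeMap K E)).reverse.prod v t = 0 := by
  classical
  induction v using Finsupp.induction_linear with
  | zero => simp
  | add f g hf hg => simp [hf, hg]
  | single r c =>
    by_cases hr : ∃ u, LabelPath E w r u
    · obtain ⟨u, hu⟩ := hr
      rw [prod_edgeMap_single hE hu, Finsupp.single_apply, if_neg]
      rintro rfl
      exact h ⟨r, hu⟩
    · rw [prod_edgeMap_single_eq_zero hE hr]
      rfl

/-- In a primitive graph, every nonzero vector can be moved along a path to a multiple of a single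
vertex. -/
theorem IsPrimitiveGraph.exists_eq_single (h : IsPrimitiveGraph n E o) (v : S →₀ K) (hv : v ≠ 0) :
    ∃ (w : List ι) (s : S) (c : K), c ≠ 0 ∧ (w.map (edgeMap K E)).reverse.prod v = Finsupp.single s c := by
  classical
  induction hN : v.support.card using Nat.strong_induction_on generalizing v with
  | _ N ih =>
    obtain ⟨s, hs⟩ := Finsupp.support_nonempty_iff.2 hv
    by_cases hsub : ∀ t ∈ v.support, t = s
    · refine ⟨[], s, v s, Finsupp.mem_support_iff.1 hs, ?_⟩
      simp only [List.map_nil, List.reverse_nil, List.prod_nil, Module.End.one_apply]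
      ext t
      by_cases ht : t = s
      · simp [ht]
      · rw [Finsupp.single_eq_of_ne ht]
        by_contra h0
        exact ht (hsub t (Finsupp.mem_support_iff.2 h0))
    · push Not at hsub
      obtain ⟨t, ht, hts⟩ := hsub
      obtain ⟨w, p, q, r, hp, hq, hpr, hqn⟩ : ∃ w p q r, p ∈ v.support ∧ q ∈ v.support ∧
          LabelPath E w p r ∧ ¬ ∃ u, LabelPath E w q u := by
        obtain ⟨w, hw⟩ := h.exists_separating hts
        by_cases h1 : ∃ u, LabelPath E w t u
        · obtain ⟨r, hr⟩ := h1
          exact ⟨w, t, s, r, ht, hs, hr, fun h2 => hw ⟨fun _ => h2, fun _ => ⟨r, hr⟩⟩⟩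
        · by_cases h2 : ∃ u, LabelPath E w s u
          · obtain ⟨r, hr⟩ := h2
            exact ⟨w, s, t, r, hs, ht, hr, h1⟩
          · exact absurd ⟨fun h => absurd h h1, fun h => absurd h h2⟩ hw
      set v' := (w.map (edgeMap K E)).reverse.prod v with hv'
      have hv'r : v' r = v p := prod_edgeMap_apply h.right_unique h.left_unique hpr v
      have hv'0 : v' ≠ 0 := by
        intro h0
        rw [h0] at hv'r
        exact Finsupp.mem_support_iff.1 hp hv'r.symm
      have hpre : ∀ u ∈ v'.support, ∃ s ∈ v.support.erase q, LabelPath E w s u := by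
        intro u hu
        rw [Finsupp.mem_support_iff] at hu
        by_cases hex : ∃ s, LabelPath E w s u
        · obtain ⟨s, hs⟩ := hex
          rw [hv', prod_edgeMap_apply h.right_unique h.left_unique hs] at hu
          refine ⟨s, Finset.mem_erase.2 ⟨?_, Finsupp.mem_support_iff.2 hu⟩, hs⟩
          rintro rfl
          exact hqn ⟨u, hs⟩
        · exact absurd (prod_edgeMap_apply_eq_zero h.right_unique hex v) hu
      have hcard : v'.support.card < N := by
        rw [← hN]
        refine lt_of_le_of_lt ?_ (Finset.card_erase_lt_of_mem hq)
        choose! g hg hg' using hpre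
        refine Finset.card_le_card_of_injOn g hg fun u hu u' hu' huu' => ?_
        have := hg' u hu
        rw [huu'] at this
        exact this.right_unique h.right_unique (hg' u' hu')
      obtain ⟨w', s', c, hc, hw'⟩ := ih _ hcard v' hv'0 rfl
      exact ⟨w ++ w', s', c, hc, by
        rw [List.map_append, List.reverse_append, List.prod_append, Module.End.mul_apply, ← hv', hw']⟩

theorem IsGoodWordAlgebra.exists_simple_faithful.{v, w} {K : Type (max v u)} {ι : Type w}
    {R : Type*} [Field K] [Ring R] [Algebra K R] {x : ι → R} {S : Type v}
    {E : ι → S → S → Prop} {o : S}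
    (hx : IsGoodWordAlgebra K n x) (h : IsPrimitiveGraph n E o) :
    ∃ (V : Type max v u) (_ : AddCommGroup V) (_ : Module R V),
      IsSimpleModule R V ∧ FaithfulSMul R V := by
  classical
  obtain ⟨φ, hφ⟩ := hx.exists_lift (Module.End K (S →₀ K)) (edgeMap K E) fun w hl hd => by
    ext s : 1
    refine LinearMap.ext_ring ?_
    have := prod_edgeMap_single_eq_zero (K := K) h.right_unique (w := w.reverse) (s := s)
      (fun ⟨t, ht⟩ => h.good _ _ _ ht w.reverse List.infix_rfl (by simpa using hl)
        (List.nodup_reverse.2 hd)) 1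
    simpa [List.map_reverse] using this
  have hφw : ∀ w : List ι, φ (w.map x).reverse.prod = (w.map (edgeMap K E)).reverse.prod := by
    intro w
    rw [map_list_prod, List.map_reverse, List.map_map]
    congr 3
    ext1 i
    exact hφ i
  let _ : Module R (S →₀ K) := Module.compHom _ φ.toRingHom
  have hsmul : ∀ (r : R) (v : S →₀ K), r • v = φ r v := fun _ _ => rfl
  refine ⟨S →₀ K, inferInstance, inferInstance, ?_, ?_⟩
  · rw [isSimpleModule_iff_toSpanSingleton_surjective]
    refine ⟨⟨Finsupp.single o 1, 0, by simp⟩, fun v hv u => ?_⟩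
    simp only [LinearMap.toSpanSingleton_apply]
    obtain ⟨w, s, c, hc, hw⟩ := h.exists_eq_single v hv
    induction u using Finsupp.induction_linear with
    | zero => exact ⟨0, zero_smul _ _⟩
    | add f g hf hg =>
      obtain ⟨r, rfl⟩ := hf
      obtain ⟨r', rfl⟩ := hg
      exact ⟨r + r', add_smul _ _ _⟩
    | single t d =>
      obtain ⟨w1, hw1⟩ := h.to_base s
      obtain ⟨w2, hw2⟩ := h.from_base t
      refine ⟨(d * c⁻¹) • (((w1 ++ w2).map x).reverse.prod * (w.map x).reverse.prod), ?_⟩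
      rw [hsmul, map_smul, map_mul, hφw, hφw, LinearMap.smul_apply, Module.End.mul_apply, hw,
        prod_edgeMap_single h.right_unique (hw1.append hw2), Finsupp.smul_single, smul_eq_mul,
        inv_mul_cancel_right₀ hc]
  · suffices ∀ r : R, (∀ v : S →₀ K, r • v = 0) → r = 0 by
      refine ⟨fun {r r'} hr => sub_eq_zero.1 (this _ fun v => ?_)⟩
      rw [sub_smul, hr, sub_self]
    intro r hr
    have hmem : r ∈ Submodule.span K ((fun w : List ι => (w.map x).reverse.prod) ''
        {w | GoodWord n w}) := by
      have : r ∈ (⊤ : Submodule K R) := trivial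
      rw [← hx.span_eq_top] at this
      refine Submodule.span_mono ?_ this
      rintro _ ⟨w, hw, rfl⟩
      exact ⟨w.reverse, hw.reverse, by simp [List.map_reverse]⟩
    rw [Finsupp.mem_span_image_iff_linearCombination] at hmem
    obtain ⟨f, hf, rfl⟩ := hmem
    rw [Finsupp.mem_supported] at hf
    suffices f = 0 by simp [this]
    ext w
    by_contra hw
    obtain ⟨s, t, hst, huniq⟩ := h.detects w (hf (Finsupp.mem_support_iff.2 hw))
      (f.support.sup List.length)
    refine hw ?_
    have h1 := congrArg (fun v => v t) (hr (Finsupp.single s 1))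
    simp only [hsmul, Finsupp.linearCombination_apply, Finsupp.sum, map_sum, map_smul, hφw,
      LinearMap.sum_apply, LinearMap.smul_apply, Finsupp.finsetSum_apply, Finsupp.smul_apply,
      Finsupp.coe_zero, Pi.zero_apply] at h1
    rw [Finset.sum_eq_single w] at h1
    · rwa [prod_edgeMap_single h.right_unique hst, Finsupp.single_eq_same, smul_eq_mul,
        mul_one] at h1
    · intro w' hw' hne
      rw [smul_eq_zero]
      right
      by_cases hex : ∃ u, LabelPath E w' s u
      · obtain ⟨u, hu⟩ := hex
        rw [prod_edgeMap_single h.right_unique hu, Finsupp.single_apply, if_neg]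
        rintro rfl
        exact hne (huniq w' (Finset.le_sup (f := List.length) hw') hu)
      · rw [prod_edgeMap_single_eq_zero h.right_unique hex]
        rfl
    · intro h0
      rw [Finsupp.notMem_support_iff.1 h0, zero_smul]

end PrimitiveModule

section SymmetricMonoid

theorem exists_perm_of_nodup {n : ℕ} {w : List (Fin n)} (hl : w.length = n) (hd : w.Nodup) :
    ∃ σ : Equiv.Perm (Fin n), w = (List.finRange n).map σ := by
  have hinj : Function.Injective fun i : Fin n => w.get (i.cast hl.symm) :=
    (List.nodup_iff_injective_get.1 hd).comp (Fin.cast_injective _)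
  refine ⟨Equiv.ofBijective _ (Finite.injective_iff_bijective.1 hinj), ?_⟩
  refine List.ext_get (by simp [hl]) fun i h1 h2 => ?_
  simp

/-- The class in `S_n(Sym_n)` of a word. -/
theorem prod_map_mgen {n : ℕ} (w : List (Fin n)) :
    (w.map mgen).prod = ((conGen (symRel n)).mk' (FreeMonoid.ofList w) : Msym n) := by
  induction w with
  | nil => rfl
  | cons a w ih => rw [List.map_cons, List.prod_cons, ih]; rfl

theorem permWord_eq_ofList (n : ℕ) (σ : Equiv.Perm (Fin n)) :
    permWord n σ = FreeMonoid.ofList ((List.finRange n).map σ) := by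
  rw [permWord]
  generalize List.finRange n = l
  induction l with
  | nil => rfl
  | cons a w ih => rw [List.map_cons, List.prod_cons, ih]; rfl

theorem prod_map_mgen_of_nodup {n : ℕ} {w : List (Fin n)} (hl : w.length = n) (hd : w.Nodup) :
    (w.map mgen).prod = zs n := by
  obtain ⟨σ, rfl⟩ := exists_perm_of_nodup hl hd
  rw [zs, prod_map_mgen, prod_map_mgen, ← permWord_eq_ofList]
  have h1 : FreeMonoid.ofList (List.finRange n) = permWord n 1 := by
    simp [permWord_eq_ofList]
  rw [h1]
  exact ((Con.eq _).2 (ConGen.Rel.of _ _ ⟨rfl, σ, rfl⟩)).symm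

/-- A monoid homomorphism out of `S_n(Sym_n)` from elements whose products of `n` distinct ones
vanish. -/
theorem exists_hom_msym {n : ℕ} {B : Type*} [MonoidWithZero B] (y : Fin n → B)
    (hy : ∀ w : List (Fin n), w.length = n → w.Nodup → (w.map y).prod = 0) :
    ∃ f : Msym n →* B, ∀ i, f (mgen i) = y i := by
  have h0 : ∀ σ, FreeMonoid.lift y (permWord n σ) = 0 := fun σ => by
    rw [permWord_eq_ofList, FreeMonoid.lift_ofList]
    exact hy _ (by simp) ((List.nodup_finRange n).map σ.injective)
  refine ⟨(conGen (symRel n)).lift (FreeMonoid.lift y) (Con.conGen_le.2 ?_), fun i => ?_⟩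
  · rintro _ _ ⟨rfl, σ, rfl⟩
    exact (h0 1).trans (h0 σ).symm
  · exact (Con.lift_mk' _ _).trans (FreeMonoid.lift_eval_of _ _)

theorem isGoodWordAlgebra_quotient {K : Type*} [Field K] {n : ℕ}
    {KMz : Submodule K (MonoidAlgebra K (Msym n))}
    (hKMz : KMz = Submodule.span K (MonoidAlgebra.of K (Msym n) '' {x | ∃ m, x = m * zs n}))
    {c : RingCon (MonoidAlgebra K (Msym n))}
    (hc : c = ringConGen (fun x y => x - y ∈ KMz)) :
    IsGoodWordAlgebra K n
      fun i => RingCon.mkₐ K c (MonoidAlgebra.of K (Msym n) (mgen i)) where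
  span_eq_top := by
    set g := RingCon.mkₐ K c with hg
    have hprod : ∀ w : List (Fin n),
        (w.map fun i => g (MonoidAlgebra.of K (Msym n) (mgen i))).prod =
          g (MonoidAlgebra.of K (Msym n) (w.map mgen).prod) := by
      intro w
      simp [map_list_prod, Function.comp_def]
    have hz : ∀ p, g (MonoidAlgebra.of K (Msym n) (p * zs n)) = 0 := by
      intro p
      rw [← map_zero g]
      refine (RingCon.eq c).2 ?_
      rw [hc]
      refine RingConGen.Rel.of _ _ ?_
      rw [sub_zero, hKMz]
      exact Submodule.subset_span ⟨_, ⟨p, rfl⟩, rfl⟩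
    have hmem : ∀ u : Msym n, g (MonoidAlgebra.of K (Msym n) u) ∈ Submodule.span K
        {r | ∃ w, GoodWord n w ∧
          (w.map fun i => g (MonoidAlgebra.of K (Msym n) (mgen i))).prod = r} := by
      intro u
      obtain ⟨w, rfl⟩ : ∃ w : List (Fin n), (w.map mgen).prod = u := by
        obtain ⟨w, rfl⟩ := Con.mk'_surjective (c := conGen (symRel n)) u
        exact ⟨FreeMonoid.toList w, prod_map_mgen _⟩
      by_cases hw : GoodWord n w
      · exact Submodule.subset_span ⟨w, hw, hprod w⟩
      · simp only [GoodWord, not_forall, not_not] at hw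
        obtain ⟨v, ⟨p, q, rfl⟩, hl, hd⟩ := hw
        rw [List.map_append, List.prod_append, List.map_append, List.prod_append,
          prod_map_mgen_of_nodup hl hd, map_mul, map_mul, hz, zero_mul]
        exact Submodule.zero_mem _
    rw [eq_top_iff]
    rintro r -
    obtain ⟨r, rfl⟩ := RingCon.mkₐ_surjective (α := K) c r
    rw [← hg]
    induction r using MonoidAlgebra.induction_on with
    | of u => exact hmem u
    | add x y hx hy => rw [map_add]; exact Submodule.add_mem _ hx hy
    | smul k x hx => rw [map_smul]; exact Submodule.smul_mem _ _ hx
  exists_lift B _ _ y hy := by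
    obtain ⟨f, hf⟩ := exists_hom_msym y hy
    have hfz : f (zs n) = 0 := by
      rw [zs, map_list_prod, List.map_map, ← hy _ List.length_finRange (List.nodup_finRange n)]
      congr 2
      ext1 i
      exact hf i
    refine ⟨RingCon.liftₐ c (MonoidAlgebra.lift K B (Msym n) f) ?_, fun i => ?_⟩
    · rw [hc, RingCon.ringConGen_le]
      intro x y hxy
      change MonoidAlgebra.lift K B (Msym n) f x = MonoidAlgebra.lift K B (Msym n) f y
      rw [← sub_eq_zero, ← map_sub]
      have : KMz ≤ LinearMap.ker (MonoidAlgebra.lift K B (Msym n) f).toLinearMap := by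
        rw [hKMz, Submodule.span_le]
        rintro _ ⟨_, ⟨m, rfl⟩, rfl⟩
        simp [hfz]
      exact this hxy
    · simp [hf]

end SymmetricMonoid

/-- the quotient ring `K[M]/K[Mz]` (the quotient of `K[M]` by the ring
congruence determined by the two-sided ideal `K[Mz]`) is left and right primitive:
it has a faithful simple left module and a faithful simple right module (a module over
the opposite ring). -/
theorem quotient_by_KMz_primitive.{u} (K : Type u) [Field K] (n : ℕ) (hn : 3 ≤ n)
    (KMz : Submodule K (MonoidAlgebra K (Msym n)))
    (hKMz : KMz = Submodule.span K (MonoidAlgebra.of K (Msym n) '' {x | ∃ m, x = m * zs n}))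
    (c : RingCon (MonoidAlgebra K (Msym n)))
    (hc : c = ringConGen (fun x y => x - y ∈ KMz)) :
    (∃ (V : Type u) (_ : AddCommGroup V) (_ : Module c.Quotient V),
        IsSimpleModule c.Quotient V ∧ FaithfulSMul c.Quotient V) ∧
    (∃ (V : Type u) (_ : AddCommGroup V) (_ : Module (c.Quotient)ᵐᵒᵖ V),
        IsSimpleModule (c.Quotient)ᵐᵒᵖ V ∧ FaithfulSMul (c.Quotient)ᵐᵒᵖ V) := by
  have hx := isGoodWordAlgebra_quotient hKMz hc
  have hab : (⟨0, by omega⟩ : Fin n) ≠ ⟨1, by omega⟩ := by simp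
  obtain ⟨S, E, o, h⟩ := exists_isPrimitiveGraph hn hab
  exact ⟨hx.exists_simple_faithful h, hx.op.exists_simple_faithful h⟩
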